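/- Let X be a finite set with #X ≥ 2. The set of primitive elements of F(X), i.e., the set {w ∈ F(X) : w = α(x) for some α ∈ Aut F(X) and some x ∈ X}, is exponentially F(X)-negligible. -/

import Mathlib

/-! Common definitions: cyclic length, Whitehead automorphisms, the sets TS, TS', L(ε),
balls, and exponential genericity in the free group F(X). -/

/-- The cyclic length ‖w‖_X : the minimum of |g w g⁻¹|_X over g ∈ F(X). -/
noncomputable def cyclicLength {X : Type} [DecidableEq X] (w : FreeGroup X) : ℕ :=
  sInf (Set.range fun g : FreeGroup X => FreeGroup.norm (g * w * g⁻¹))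

/-- w is cyclically reduced if |w|_X = ‖w‖_X. -/
def CyclicallyReduced {X : Type} [DecidableEq X] (w : FreeGroup X) : Prop :=
  FreeGroup.norm w = cyclicLength w

/-- The set X^± = X ∪ X⁻¹ of letters, viewed inside F(X). -/
def Xpm (X : Type) : Set (FreeGroup X) :=
  (Set.range fun x : X => FreeGroup.of x) ∪ (Set.range fun x : X => (FreeGroup.of x)⁻¹)

/-- σ is a type I (relabeling) Whitehead automorphism: there is a bijection π of X^±
commuting with inversion such that σ(x) = π(x) for all x ∈ X. -/
def IsTypeI {X : Type} (σ : MulAut (FreeGroup X)) : Prop :=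
  ∃ π : FreeGroup X → FreeGroup X,
    Set.BijOn π (Xpm X) (Xpm X) ∧
    (∀ x ∈ Xpm X, π x⁻¹ = (π x)⁻¹) ∧
    (∀ x : X, σ (FreeGroup.of x) = π (FreeGroup.of x))

/-- σ is a type II Whitehead automorphism: there is a ∈ X^± with σ(a) = a and
σ(x) ∈ {x, xa, a⁻¹x, a⁻¹xa} for every x ∈ X^±. -/
def IsTypeII {X : Type} (σ : MulAut (FreeGroup X)) : Prop :=
  ∃ a ∈ Xpm X, σ a = a ∧
    ∀ x ∈ Xpm X, σ x = x ∨ σ x = x * a ∨ σ x = a⁻¹ * x ∨ σ x = a⁻¹ * x * a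

/-- σ is inner if it is conjugation by some element of F(X). -/
def IsInnerAut {X : Type} (σ : MulAut (FreeGroup X)) : Prop :=
  ∃ g : FreeGroup X, σ = MulAut.conj g

/-- w is a proper power if w = z^r for some z and some integer r ≥ 2. -/
def IsProperPower {X : Type} (w : FreeGroup X) : Prop :=
  ∃ z : FreeGroup X, ∃ r : ℕ, 2 ≤ r ∧ w = z ^ r

/-- TS is the set of cyclically reduced w that are not proper powers, whose cyclic length
is strictly increased by every non-inner type II Whitehead automorphism, and whose
conjugacy class is fixed by no non-identity type I Whitehead automorphism. -/
def TS (X : Type) [DecidableEq X] : Set (FreeGroup X) :=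
  {w | CyclicallyReduced w ∧ ¬ IsProperPower w ∧
    (∀ τ : MulAut (FreeGroup X), IsTypeII τ → ¬ IsInnerAut τ →
      cyclicLength w < cyclicLength (τ w)) ∧
    (∀ σ : MulAut (FreeGroup X), IsTypeI σ → σ ≠ 1 → ¬ IsConj w (σ w))}

/-- The set of elements of F(X) whose cyclic reduction lies in S. -/
def cyclicPreimage {X : Type} [DecidableEq X] (S : Set (FreeGroup X)) : Set (FreeGroup X) :=
  {w | ∃ g u : FreeGroup X, u ∈ S ∧ CyclicallyReduced u ∧ w = g * u * g⁻¹ ∧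
    FreeGroup.norm w = 2 * FreeGroup.norm g + FreeGroup.norm u}

/-- TS' is the set of elements of F(X) whose cyclic reduction lies in TS. -/
def TS' (X : Type) [DecidableEq X] : Set (FreeGroup X) :=
  cyclicPreimage (TS X)

/-- The ball B_n = {w ∈ F(X) : |w|_X ≤ n}. -/
def ballF (X : Type) [DecidableEq X] (n : ℕ) : Set (FreeGroup X) :=
  {w | FreeGroup.norm w ≤ n}

/-- S is exponentially T-generic: there are C > 0 and s ∈ (0,1) with
#((T∖S) ∩ B_n) ≤ C·s^n·#(T ∩ B_n) for all n. -/
def ExpGeneric {X : Type} [DecidableEq X] (S T : Set (FreeGroup X)) : Prop :=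
  ∃ C : ℝ, 0 < C ∧ ∃ s : ℝ, 0 < s ∧ s < 1 ∧
    ∀ n : ℕ, (((T \ S) ∩ ballF X n).ncard : ℝ) ≤ C * s ^ n * ((T ∩ ballF X n).ncard : ℝ)

/-- L(ε): the set of cyclically reduced w of length n ≥ 1 all of whose one-letter
frequencies lie in (1/(2N) − ε, 1/(2N) + ε) and all of whose cyclic two-letter
frequencies (for y ≠ x⁻¹) lie in (1/(2N(2N−1)) − ε, 1/(2N(2N−1)) + ε). -/
def Lset (X : Type) [Fintype X] [DecidableEq X] (ε : ℝ) : Set (FreeGroup X) :=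
  {w | CyclicallyReduced w ∧ 1 ≤ FreeGroup.norm w ∧
    ∀ x y : X × Bool, y ≠ (x.1, !x.2) →
      |((w.toWord.count x : ℝ) / (FreeGroup.norm w : ℝ)) -
        1 / (2 * (Fintype.card X : ℝ))| < ε ∧
      |(((w.toWord.zip (w.toWord.rotate 1)).count (x, y) : ℝ) / (FreeGroup.norm w : ℝ)) -
        1 / (2 * (Fintype.card X : ℝ) * (2 * (Fintype.card X : ℝ) - 1))| < ε}

namespace FreeGroup

section AlmostInvariant

variable {X : Type}

/-- The symmetric difference of `E` and each of its right translates is finite. -/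
def AlmostInvariant (E : Set (FreeGroup X)) : Prop :=
  ∀ s : FreeGroup X, {h | ¬(h * s ∈ E ↔ h ∈ E)}.Finite

theorem almostInvariant_of_letters {E : Set (FreeGroup X)}
    (hE : ∀ x : X, {h | ¬(h * of x ∈ E ↔ h ∈ E)}.Finite) : AlmostInvariant E := by
  intro s
  induction s using FreeGroup.induction_on with
  | C1 => simp
  | of x => exact hE x
  | inv_of x _ =>
    refine ((hE x).image (· * of x)).subset ?_
    intro h hh
    refine ⟨h * (of x)⁻¹, ?_, by simp⟩
    simp only [Set.mem_ofPred_eq, inv_mul_cancel_right] at hh ⊢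
    tauto
  | mul a b ha hb =>
    refine (ha.union (hb.image (· * a⁻¹))).subset ?_
    intro h hh
    by_cases h1 : h * a ∈ E ↔ h ∈ E
    · right
      refine ⟨h * a, ?_, by simp⟩
      simp only [Set.mem_ofPred_eq, mul_assoc] at hh ⊢
      tauto
    · exact Or.inl h1

theorem AlmostInvariant.preimage {E : Set (FreeGroup X)} (hE : AlmostInvariant E)
    (β : FreeGroup X ≃* FreeGroup X) : AlmostInvariant (β ⁻¹' E) := by
  intro s
  refine ((hE (β s)).preimage β.injective.injOn).subset ?_
  intro h hh
  simpa using hh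

theorem IsReduced.subword {L₁ L₂ : List (X × Bool)} (h : IsReduced L₂) (h' : L₁ <:+: L₂) :
    IsReduced L₁ := by
  obtain ⟨A, B, rfl⟩ := h'
  exact (List.IsChain.left_of_append h).right_of_append

variable [DecidableEq X]

theorem isReduced_invRev {L : List (X × Bool)} (h : IsReduced L) : IsReduced (invRev L) := by
  rw [isReduced_iff_reduce_eq, reduce_invRev, h.reduce_eq]

theorem toWord_mul_letter (h : FreeGroup X) (s : X × Bool) :
    (h * mk [s]).toWord = h.toWord ++ [s] ∨
      h.toWord = (h * mk [s]).toWord ++ [(s.1, !s.2)] := by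
  have hr : IsReduced h.toWord := isReduced_toWord
  have hm : h * mk [s] = mk (h.toWord ++ [s]) := by
    rw [← mul_mk, mk_toWord]
  rcases List.eq_nil_or_concat h.toWord with h0 | ⟨L, b, hL⟩
  · left
    rw [hm, toWord_mk, h0]
    rfl
  · rw [List.concat_eq_append] at hL
    by_cases hb : b = (s.1, !s.2)
    · right
      have : mk (L ++ [(s.1, !s.2)] ++ [s]) = mk L := by
        rw [List.append_assoc]
        refine (Quot.sound (Red.Step.not_rev (L₁ := L) (L₂ := []) (x := s.1) (b := s.2))).trans ?_
        rw [List.append_nil]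
        rfl
      rw [hm, hL, hb, this, toWord_mk, IsReduced.reduce_eq]
      exact hr.subword ⟨[], [b], by simp [hL]⟩
    · left
      rw [hm, toWord_mk]
      apply IsReduced.reduce_eq
      rw [hL] at hr ⊢
      refine IsReduced.append_overlap hr ?_ (by simp)
      simp only [List.cons_append, List.nil_append, isReduced_cons_cons, IsReduced.singleton,
        and_true]
      intro h1
      by_contra h2
      exact hb (Prod.ext h1 (by simpa [Bool.eq_not] using h2))

/-- The elements whose reduced word starts with the generator `y`. -/
def startingWith (y : X) : Set (FreeGroup X) :=
  {h | h.toWord.head? = some (y, true)}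

theorem mem_startingWith_mul_letter {y : X} {h : FreeGroup X} {s : X × Bool}
    (hs : s.1 ≠ y ∨ (h ≠ 1 ∧ h * mk [s] ≠ 1)) :
    h * mk [s] ∈ startingWith y ↔ h ∈ startingWith y := by
  have key : ∀ (g g' : FreeGroup X) (t : X × Bool), t.1 = s.1 → g'.toWord = g.toWord ++ [t] →
      (s.1 ≠ y ∨ g ≠ 1) → (g' ∈ startingWith y ↔ g ∈ startingWith y) := by
    intro g g' t ht e hg
    simp only [startingWith, Set.mem_ofPred_eq, e, List.head?_append]
    rcases hw : g.toWord with _ | ⟨a, L⟩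
    · rw [toWord_eq_nil_iff] at hw
      have hy : s.1 ≠ y := by tauto
      simp only [List.head?_nil, Option.none_or, List.head?_cons, Option.some.injEq, reduceCtorEq,
        iff_false]
      rintro rfl
      exact hy ht.symm
    · simp
  rcases toWord_mul_letter h s with e | e
  · exact key _ _ s rfl e (by tauto)
  · exact (key _ _ (s.1, !s.2) rfl e (by tauto)).symm

theorem almostInvariant_startingWith (y : X) : AlmostInvariant (startingWith y) := by
  refine almostInvariant_of_letters fun x => ?_
  refine (Set.toFinite {1, (of x)⁻¹}).subset ?_
  intro h hh
  by_contra hn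
  simp only [Set.mem_insert_iff, Set.mem_singleton_iff, not_or] at hn
  refine hh (mem_startingWith_mul_letter (s := (x, true)) (Or.inr ⟨hn.1, ?_⟩))
  intro h1
  exact hn.2 (eq_inv_of_mul_eq_one_left h1)

theorem infinite_startingWith (y : X) : (startingWith y).Infinite := by
  refine Set.infinite_of_injective_forall_mem (f := fun n : ℕ => of y ^ (n + 1)) ?_ ?_
  · intro m n h
    simpa using congrArg norm h
  · intro n
    simp [startingWith, List.replicate_succ]

theorem infinite_compl_startingWith {x y : X} (hxy : x ≠ y) : (startingWith y)ᶜ.Infinite := by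
  refine Set.infinite_of_injective_forall_mem (f := fun n : ℕ => of x ^ (n + 1)) ?_ ?_
  · intro m n h
    simpa using congrArg norm h
  · intro n
    simp [startingWith, List.replicate_succ, hxy]

theorem finite_norm_le [Finite X] (R : ℕ) : {h : FreeGroup X | norm h ≤ R}.Finite :=
  (List.finite_length_le (X × Bool) R).preimage toWord_injective.injOn

theorem AlmostInvariant.exists_radius [Finite X] {E : Set (FreeGroup X)} (hE : AlmostInvariant E) :
    ∃ R : ℕ, ∀ h : FreeGroup X, R ≤ norm h → ∀ s : X × Bool, h * mk [s] ∈ E ↔ h ∈ E := by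
  have hfin : (⋃ s : X × Bool, {h | ¬(h * mk [s] ∈ E ↔ h ∈ E)}).Finite :=
    Set.finite_iUnion fun s => hE (mk [s])
  obtain ⟨R, hR⟩ := (hfin.image norm).bddAbove
  refine ⟨R + 1, fun h hh s => ?_⟩
  by_contra hn
  have := hR ⟨h, Set.mem_iUnion.2 ⟨s, hn⟩, rfl⟩
  omega

theorem mem_iff_of_append {E : Set (FreeGroup X)} {R : ℕ}
    (hR : ∀ h : FreeGroup X, R ≤ norm h → ∀ s : X × Bool, h * mk [s] ∈ E ↔ h ∈ E)
    {L : List (X × Bool)} (hL : R ≤ L.length) (M : List (X × Bool)) (hM : IsReduced (L ++ M)) :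
    mk (L ++ M) ∈ E ↔ mk L ∈ E := by
  induction M using List.reverseRecOn with
  | nil => simp
  | append_singleton M s ih =>
    have hr : IsReduced (L ++ M) := hM.subword ⟨[], [s], by simp⟩
    rw [← ih hr, ← List.append_assoc, ← mul_mk]
    apply hR
    rw [norm, toWord_mk, hr.reduce_eq, List.length_append]
    omega

/-- If the cyclically reduced word `u` contains every reduced two-letter word, then an almost
invariant set which is right invariant under `u` does not separate the ends. -/
theorem AlmostInvariant.mem_iff_of_radius {E : Set (FreeGroup X)} {R : ℕ}
    (hR : ∀ h : FreeGroup X, R ≤ norm h → ∀ s : X × Bool, h * mk [s] ∈ E ↔ h ∈ E)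
    {u : List (X × Bool)} (hu : IsCyclicallyReduced u)
    (hpairs : ∀ p q : X × Bool, (p.1 = q.1 → p.2 = q.2) → [p, q] <:+: u)
    (hinv : ∀ h, h * mk u ∈ E ↔ h ∈ E) :
    ∀ (k : ℕ) (L M M' : List (X × Bool)), R ≤ L.length + k →
      IsReduced (L ++ M) → IsReduced (L ++ M') →
      R ≤ (L ++ M).length → R ≤ (L ++ M').length →
      (mk (L ++ M) ∈ E ↔ mk (L ++ M') ∈ E) := by
  have hpow : ∀ (n : ℕ) (h : FreeGroup X), h * mk u ^ n ∈ E ↔ h ∈ E := by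
    intro n
    induction n with
    | zero => simp
    | succ n ih => intro h; rw [pow_succ, ← mul_assoc, hinv, ih]
  intro k
  induction k with
  | zero =>
    intro L M M' hk hM hM' _ _
    rw [mem_iff_of_append hR hk M hM, mem_iff_of_append hR hk M' hM']
  | succ k ih =>
    intro L M M' hk hM hM' hl hl'
    by_cases hLR : R ≤ L.length
    · rw [mem_iff_of_append hR hLR M hM, mem_iff_of_append hR hLR M' hM']
    rw [List.length_append] at hl hl'
    obtain ⟨s, M, rfl⟩ := List.exists_cons_of_length_pos (l := M) (by omega)
    obtain ⟨s', M', rfl⟩ := List.exists_cons_of_length_pos (l := M') (by omega)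
    have hstep : ∀ (t : X × Bool) (N N' : List (X × Bool)), IsReduced (L ++ t :: N) →
        IsReduced (L ++ t :: N') → R ≤ (L ++ t :: N).length → R ≤ (L ++ t :: N').length →
        (mk (L ++ t :: N) ∈ E ↔ mk (L ++ t :: N') ∈ E) := by
      intro t N N' h1 h2 h3 h4
      have := ih (L ++ [t]) N N' (by simp; omega) (by simpa using h1) (by simpa using h2)
        (by simpa using h3) (by simpa using h4)
      simpa using this
    by_cases hss : s = s'
    · subst hss
      exact hstep s M M' hM hM' (by simpa using hl) (by simpa using hl')
    obtain ⟨a, b, hab⟩ := hpairs (s.1, !s.2) s' (by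
      intro h1
      by_contra h2
      exact hss (Prod.ext h1 (by simpa [Bool.eq_not] using h2)))
    set V := (List.replicate R u).flatten with hV
    have hVlen : R ≤ V.length := by
      have : 1 ≤ u.length := by rw [← hab]; simp; omega
      simp only [hV, List.length_flatten, List.map_replicate, List.sum_replicate, smul_eq_mul]
      nlinarith
    have hVmk : mk V = mk u ^ R := by rw [pow_mk]
    have hVu : IsReduced (V ++ u) := by
      have := (hu.flatten_replicate (R + 1)).isReduced
      rwa [List.replicate_succ', List.flatten_concat] at this
    have huV : IsReduced (u ++ V) := by
      have := (hu.flatten_replicate (R + 1)).isReduced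
      rwa [List.replicate_succ, List.flatten_cons] at this
    have hred : IsReduced (L ++ s :: invRev (V ++ a)) := by
      have h1 : IsReduced (L ++ [s]) := hM.subword ⟨[], M, by simp⟩
      have h2 : IsReduced ([s] ++ invRev (V ++ a)) := by
        have := isReduced_invRev (hVu.subword (L₁ := V ++ a ++ [(s.1, !s.2)])
          ⟨[], s' :: b, by simp [← hab]⟩)
        simpa [invRev] using this
      simpa using h1.append_overlap h2 (by simp)
    have hred' : IsReduced (L ++ s' :: (b ++ V)) := by
      have h1 : IsReduced (L ++ [s']) := hM'.subword ⟨[], M', by simp⟩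
      have h2 : IsReduced ([s'] ++ (b ++ V)) :=
        huV.subword ⟨a ++ [(s.1, !s.2)], [], by simp [← hab]⟩
      simpa using h1.append_overlap h2 (by simp)
    rw [hstep s M (invRev (V ++ a)) hM hred (by simpa using hl) (by simp; omega),
      hstep s' M' (b ++ V) hM' hred' (by simpa using hl') (by simp; omega),
      ← hpow (R + 1 + R) (mk (L ++ s :: invRev (V ++ a)))]
    suffices mk (L ++ s :: invRev (V ++ a)) * mk u ^ (R + 1 + R) = mk (L ++ s' :: (b ++ V)) by
      rw [this]
    have e1 : mk (L ++ s :: invRev (V ++ a)) =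
        mk L * (mk u ^ R * mk (a ++ [(s.1, !s.2)]))⁻¹ := by
      rw [← hVmk, mul_mk, inv_mk, mul_mk]
      simp [invRev]
    have e2 : mk (L ++ s' :: (b ++ V)) = mk L * (mk (s' :: b) * mk u ^ R) := by
      rw [← hVmk, mul_mk, mul_mk]
      simp
    have e3 : mk u = mk (a ++ [(s.1, !s.2)]) * mk (s' :: b) := by
      rw [mul_mk, ← hab]
      simp
    rw [e1, e2, pow_add, pow_add, pow_one]
    nth_rw 3 [e3]
    group

/-- A cyclically reduced word containing every reduced two-letter word is not a member of a basis
of the free group. -/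
theorem exists_pair_omitted [Finite X] [Nontrivial X] {u : List (X × Bool)} (hu : IsCyclicallyReduced u)
    (β : FreeGroup X ≃* FreeGroup X) {x : X} (hβ : β (mk u) = of x) :
    ∃ p q : X × Bool, (p.1 = q.1 → p.2 = q.2) ∧ ¬[p, q] <:+: u := by
  by_contra! hpairs
  obtain ⟨y, hy⟩ := exists_ne x
  have hE : AlmostInvariant (β ⁻¹' startingWith y) := (almostInvariant_startingWith y).preimage β
  obtain ⟨R, hR⟩ := hE.exists_radius
  have hinv : ∀ h, h * mk u ∈ β ⁻¹' startingWith y ↔ h ∈ β ⁻¹' startingWith y := by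
    intro h
    rw [Set.mem_preimage, Set.mem_preimage, _root_.map_mul, hβ]
    exact mem_startingWith_mul_letter (s := (x, true)) (Or.inl hy.symm)
  have key := AlmostInvariant.mem_iff_of_radius hR hu hpairs hinv R []
  have large : ∀ S : Set (FreeGroup X), S.Infinite → ∃ h ∈ β ⁻¹' S, R ≤ norm h := by
    intro S hS
    have hS' : (β ⁻¹' S).Infinite := hS.preimage (by simp [Set.range_eq_univ.2 β.surjective])
    by_contra! hn
    exact hS' ((finite_norm_le R).subset fun h hh => (hn h hh).le)
  obtain ⟨g, hg, hgR⟩ := large _ (infinite_startingWith y)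
  obtain ⟨h, hh, hhR⟩ := large _ (infinite_compl_startingWith hy.symm)
  have := key g.toWord h.toWord (by simp) isReduced_toWord isReduced_toWord hgR hhR
  simp only [List.nil_append, mk_toWord] at this
  exact hh (this.1 hg)

/-- The cyclic reduction of a primitive element omits some reduced two-letter word. -/
theorem exists_pair_omitted_of_primitive [Finite X] [Nontrivial X] (α : MulAut (FreeGroup X)) (x : X) :
    ∃ p q : X × Bool, (p.1 = q.1 → p.2 = q.2) ∧
      ¬[p, q] <:+: reduceCyclically (α (of x)).toWord := by
  set w := α (of x) with hw
  set c := mk (reduceCyclically.conjugator w.toWord) with hc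
  have hcw : c * mk (reduceCyclically w.toWord) * c⁻¹ = w := by
    rw [hc, inv_mk, mul_mk, mul_mk, reduceCyclically.conj_conjugator_reduceCyclically, mk_toWord]
  refine exists_pair_omitted (reduceCyclically.isCyclicallyReduced isReduced_toWord)
    ((MulAut.conj c).trans α.symm) (x := x) ?_
  rw [MulEquiv.trans_apply, MulAut.conj_apply, hcw, hw, MulEquiv.symm_apply_apply]

end AlmostInvariant

end FreeGroup

section Chains

variable {A : Type} [Fintype A] [DecidableEq A]

/-- The lists `t` of length `l` such that `c :: t` is a chain for `r`. -/
def chainsFrom (r : A → A → Prop) [DecidableRel r] : ℕ → A → Finset (List A)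
  | 0, _ => {[]}
  | l + 1, c => (Finset.univ.filter (r c)).biUnion fun d => (chainsFrom r l d).image (List.cons d)

variable {r : A → A → Prop} [DecidableRel r]

theorem mem_chainsFrom {l : ℕ} {c : A} {t : List A} :
    t ∈ chainsFrom r l c ↔ t.length = l ∧ List.IsChain r (c :: t) := by
  induction l generalizing c t with
  | zero =>
    simp only [chainsFrom, Finset.mem_singleton, List.length_eq_zero_iff]
    constructor
    · rintro rfl; simp
    · exact And.left
  | succ l ih =>
    simp only [chainsFrom, Finset.mem_biUnion, Finset.mem_filter, Finset.mem_univ, true_and,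
      Finset.mem_image]
    constructor
    · rintro ⟨d, hd, t, ht, rfl⟩
      rw [ih] at ht
      simpa [List.isChain_cons_cons, hd, ht.1] using ht.2
    · rintro ⟨h1, h2⟩
      obtain ⟨d, t, rfl⟩ := List.exists_cons_of_length_eq_add_one h1
      rw [List.isChain_cons_cons] at h2
      exact ⟨d, h2.1, t, ih.2 ⟨by simpa using h1, h2.2⟩, rfl⟩

theorem card_chainsFrom_succ (l : ℕ) (c : A) :
    (chainsFrom r (l + 1) c).card =
      ∑ d ∈ Finset.univ.filter (r c), (chainsFrom r l d).card := by
  rw [chainsFrom, Finset.card_biUnion]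
  · exact Finset.sum_congr rfl fun d _ =>
      Finset.card_image_of_injective _ (List.cons_injective)
  · intro d _ e _ hde
    rw [Function.onFun, Finset.disjoint_left]
    intro t ht ht'
    simp only [Finset.mem_image] at ht ht'
    obtain ⟨_, _, rfl⟩ := ht
    obtain ⟨_, _, h⟩ := ht'
    simp only [List.cons.injEq] at h
    exact hde h.1.symm

theorem pow_le_card_chainsFrom {K : ℕ} (hK : ∀ c, K ≤ (Finset.univ.filter (r c)).card)
    (l : ℕ) (c : A) : K ^ l ≤ (chainsFrom r l c).card := by
  induction l generalizing c with
  | zero => simp [chainsFrom]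
  | succ l ih =>
    rw [card_chainsFrom_succ, pow_succ']
    exact (Nat.mul_le_mul_right _ (hK c)).trans
      (by simpa using Finset.card_nsmul_le_sum _ _ _ fun d _ => ih d)

theorem card_chainsFrom_succ_le {K : ℕ} (hK : ∀ c, (Finset.univ.filter (r c)).card ≤ K)
    {l M : ℕ} (hM : ∀ c, (chainsFrom r l c).card ≤ M) (c : A) :
    (chainsFrom r (l + 1) c).card ≤ K * M := by
  rw [card_chainsFrom_succ]
  exact (Finset.sum_le_card_nsmul _ _ _ fun d _ => hM d).trans
    (by simpa using Nat.mul_le_mul_right _ (hK c))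

theorem card_chainsFrom_le_pow {K : ℕ} (hK : ∀ c, (Finset.univ.filter (r c)).card ≤ K)
    (l : ℕ) (c : A) : (chainsFrom r l c).card ≤ K ^ l := by
  induction l generalizing c with
  | zero => simp [chainsFrom]
  | succ l ih =>
    rw [pow_succ']
    exact card_chainsFrom_succ_le hK ih c

theorem card_chainsFrom_succ_add_le {K : ℕ} (hK : ∀ c, (Finset.univ.filter (r c)).card ≤ K)
    {l M B : ℕ} (hB : ∀ c, (chainsFrom r l c).card ≤ B) {c d : A} (hcd : r c d)
    (hd : (chainsFrom r l d).card + M ≤ B) :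
    (chainsFrom r (l + 1) c).card + M ≤ K * B := by
  have hmem : d ∈ Finset.univ.filter (r c) := by simpa using hcd
  rw [card_chainsFrom_succ, ← Finset.add_sum_erase _ _ hmem]
  have h1 : ∑ e ∈ (Finset.univ.filter (r c)).erase d, (chainsFrom r l e).card ≤
      ((Finset.univ.filter (r c)).erase d).card * B := by
    simpa using Finset.sum_le_card_nsmul _ _ _ fun e _ => hB e
  have h2 := Finset.card_erase_add_one hmem
  have h3 : (((Finset.univ.filter (r c)).erase d).card + 1) * B ≤ K * B :=
    Nat.mul_le_mul_right _ (h2.le.trans (hK c))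
  linarith

/-- If some vertex `p` has less than `K` successors and can be reached in two steps from
everywhere, then the number of chains grows at a rate smaller than `K`. -/
theorem card_chainsFrom_le {K : ℕ} (hK : ∀ c, (Finset.univ.filter (r c)).card ≤ K)
    {p : A} (hp : (Finset.univ.filter (r p)).card + 1 ≤ K)
    (hreach : ∀ c, ∃ d, r c d ∧ r d p) {μ : ℝ} (hμ : 1 ≤ μ) (hμK : (K : ℝ) ^ 3 - 1 ≤ μ ^ 3)
    (l : ℕ) (c : A) : ((chainsFrom r l c).card : ℝ) ≤ K ^ 3 * μ ^ l := by
  have hK1 : 1 ≤ K := by omega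
  have step : ∀ l M, (∀ c, (chainsFrom r l c).card ≤ M) →
      ∀ c, (chainsFrom r (l + 3) c).card + M ≤ K ^ 3 * M := by
    intro l M hM c
    have s1 := card_chainsFrom_succ_le hK hM
    have s2 := card_chainsFrom_succ_le hK s1
    have t1 : (chainsFrom r (l + 1) p).card + M ≤ K * M := by
      rw [card_chainsFrom_succ]
      have h1 : ∑ e ∈ Finset.univ.filter (r p), (chainsFrom r l e).card ≤
          (Finset.univ.filter (r p)).card * M := by
        simpa using Finset.sum_le_card_nsmul _ _ _ fun e _ => hM e
      nlinarith [Nat.mul_le_mul_right M hp]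
    obtain ⟨d, hcd, hdp⟩ := hreach c
    have t2 := card_chainsFrom_succ_add_le hK s1 hdp t1
    have t3 := card_chainsFrom_succ_add_le hK s2 hcd t2
    calc _ ≤ _ := t3
      _ = _ := by ring
  have hK0 : (0 : ℝ) < (K : ℝ) ^ 3 := by positivity
  induction l using Nat.strong_induction_on generalizing c with
  | _ l ih =>
    rcases Nat.lt_or_ge l 3 with hl | hl
    · have h1 : ((chainsFrom r l c).card : ℝ) ≤ (K : ℝ) ^ l := by
        exact_mod_cast card_chainsFrom_le_pow hK l c
      have h2 : (K : ℝ) ^ l ≤ (K : ℝ) ^ 3 :=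
        pow_le_pow_right₀ (by exact_mod_cast hK1) hl.le
      nlinarith [one_le_pow₀ hμ (n := l)]
    · obtain ⟨m, rfl⟩ := Nat.exists_eq_add_of_le' hl
      have hne : (Finset.univ : Finset A).Nonempty := ⟨p, Finset.mem_univ p⟩
      obtain ⟨e, -, he⟩ := Finset.exists_max_image Finset.univ
        (fun e => (chainsFrom r m e).card) hne
      have h1 := step m _ (fun c => he c (Finset.mem_univ c)) c
      have h2 : ((chainsFrom r (m + 3) c).card : ℝ) + (chainsFrom r m e).card ≤
          K ^ 3 * (chainsFrom r m e).card := by exact_mod_cast h1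
      have h3 := ih m (by omega) e
      have h4 : (0 : ℝ) ≤ (chainsFrom r m e).card := by positivity
      have h5 : (0 : ℝ) ≤ (K : ℝ) ^ 3 - 1 := by
        have : (1 : ℝ) ≤ (K : ℝ) ^ 3 := one_le_pow₀ (by exact_mod_cast hK1)
        linarith
      calc ((chainsFrom r (m + 3) c).card : ℝ)
          ≤ (K ^ 3 - 1) * (chainsFrom r m e).card := by linarith
        _ ≤ (K ^ 3 - 1) * (K ^ 3 * μ ^ m) := by gcongr
        _ ≤ μ ^ 3 * (K ^ 3 * μ ^ m) := by gcongr
        _ = K ^ 3 * μ ^ (m + 3) := by ring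

end Chains

section Reals

theorem exists_rate {K : ℕ} (hK : 3 ≤ K) :
    ∃ μ : ℝ, 1 ≤ μ ∧ μ < K ∧ (K : ℝ) ^ 3 - 1 ≤ μ ^ 3 ∧ (K : ℝ) + 1 ≤ μ ^ 2 := by
  have hK' : (3 : ℝ) ≤ K := by exact_mod_cast hK
  generalize (K : ℝ) = k at *
  obtain ⟨δ, hδ⟩ : ∃ δ : ℝ, δ = 1 / (3 * k ^ 2) := ⟨_, rfl⟩
  have hδ0 : 0 < δ := by rw [hδ]; positivity
  have hδk : k ^ 2 * δ = 1 / 3 := by rw [hδ]; field_simp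
  have hδ1 : δ ≤ 1 / 9 := by nlinarith
  have hkδ : k * δ ≤ 1 / 9 := by nlinarith
  refine ⟨k - δ, by linarith, by linarith, ?_, ?_⟩
  · have : (k - δ) ^ 3 = k ^ 3 - 3 * (k ^ 2 * δ) + δ ^ 2 * (3 * k - δ) := by ring
    rw [this, hδk]
    have : 0 ≤ δ ^ 2 * (3 * k - δ) := mul_nonneg (sq_nonneg _) (by linarith)
    linarith
  · nlinarith

theorem exists_bound_sq_mul_pow {s : ℝ} (h0 : 0 < s) (h1 : s < 1) :
    ∃ C : ℝ, ∀ n : ℕ, ((n : ℝ) + 1) ^ 2 * s ^ n ≤ C := by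
  have ht := tendsto_pow_const_mul_const_pow_of_abs_lt_one 2 (abs_lt.2 ⟨by linarith, h1⟩)
  obtain ⟨C, hC⟩ := ht.bddAbove_range
  refine ⟨C / s, fun n => ?_⟩
  have := hC ⟨n + 1, rfl⟩
  rw [le_div_iff₀ h0]
  push_cast at this
  calc ((n : ℝ) + 1) ^ 2 * s ^ n * s = ((n : ℝ) + 1) ^ 2 * s ^ (n + 1) := by ring
    _ ≤ C := this

end Reals

namespace FreeGroup

section Counting

variable {X : Type}

/-- Two letters that do not cancel. -/
abbrev NonCancelling (a b : X × Bool) : Prop := a.1 = b.1 → a.2 = b.2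

theorem nonCancelling_iff {a b : X × Bool} : NonCancelling a b ↔ b ≠ (a.1, !a.2) := by
  rw [NonCancelling, ne_eq, Prod.ext_iff, not_and]
  constructor
  · intro h h1
    rw [h h1.symm]
    simp
  · intro h h1
    have := h h1.symm
    simpa [eq_comm] using this

/-- Consecutive letters of a reduced word omitting the two-letter word `p q`. -/
abbrev Avoiding (p q a b : X × Bool) : Prop := NonCancelling a b ∧ ¬(a = p ∧ b = q)

theorem isChain_avoiding {p q : X × Bool} {u : List (X × Bool)} (hu : IsReduced u)
    (hpq : ¬[p, q] <:+: u) : u.IsChain (Avoiding p q) := by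
  rw [List.isChain_iff_forall_rel_of_append_cons_cons]
  rintro a b l₁ l₂ rfl
  rw [IsReduced, List.isChain_iff_forall_rel_of_append_cons_cons] at hu
  refine ⟨hu rfl, ?_⟩
  rintro ⟨rfl, rfl⟩
  exact hpq ⟨l₁, l₂, by simp⟩

variable [Fintype X] [DecidableEq X]

theorem card_nonCancelling (a : X × Bool) :
    (Finset.univ.filter (NonCancelling a)).card = 2 * Fintype.card X - 1 := by
  have : Finset.univ.filter (NonCancelling a) = Finset.univ.erase (a.1, !a.2) := by
    ext b
    simp [nonCancelling_iff]
  rw [this, Finset.card_erase_of_mem (Finset.mem_univ _), Finset.card_univ, Fintype.card_prod,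
    Fintype.card_bool, mul_comm]

theorem exists_letter_notMem (hX : 2 ≤ Fintype.card X) (a b c : X × Bool) :
    ∃ d : X × Bool, d ≠ a ∧ d ≠ b ∧ d ≠ c := by
  have h : ({a, b, c} : Finset (X × Bool)).card < (Finset.univ : Finset (X × Bool)).card := by
    rw [Finset.card_univ, Fintype.card_prod, Fintype.card_bool]
    exact Finset.card_le_three.trans_lt (by omega)
  obtain ⟨d, -, hd⟩ := Finset.exists_mem_notMem_of_card_lt_card h
  exact ⟨d, by simpa using hd⟩

theorem card_avoiding_le (p q a : X × Bool) :
    (Finset.univ.filter (Avoiding p q a)).card ≤ 2 * Fintype.card X - 1 := by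
  rw [← card_nonCancelling a]
  exact Finset.card_le_card (Finset.monotone_filter_right _ fun b _ h => h.1)

theorem card_avoiding_self_add_one_le {p q : X × Bool} (hpq : NonCancelling p q) :
    (Finset.univ.filter (Avoiding p q p)).card + 1 ≤ 2 * Fintype.card X - 1 := by
  rw [← card_nonCancelling p, Nat.add_one_le_iff]
  refine Finset.card_lt_card (Finset.ssubset_iff_of_subset ?_ |>.2 ⟨q, ?_, ?_⟩)
  · exact Finset.monotone_filter_right _ fun b _ h => h.1
  · simpa using hpq
  · simp [Avoiding]

theorem exists_avoiding_between (hX : 2 ≤ Fintype.card X) (p q c : X × Bool) :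
    ∃ d, Avoiding p q c d ∧ Avoiding p q d p := by
  obtain ⟨d, h1, h2, h3⟩ := exists_letter_notMem hX (c.1, !c.2) (p.1, !p.2) q
  refine ⟨d, ⟨nonCancelling_iff.2 h1, fun h => h3 h.2⟩, nonCancelling_iff.2 ?_,
    fun h => h3 (h.1.trans h.2)⟩
  rintro rfl
  simp at h2

/-- The reduced words of length `l` omitting some reduced two-letter word, possibly together with
further words of length `l`. -/
def omittingWords (X : Type) [Fintype X] [DecidableEq X] (l : ℕ) : Finset (List (X × Bool)) :=
  (Finset.univ.filter fun x : (X × Bool) × (X × Bool) => NonCancelling x.1 x.2).biUnion fun x =>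
    Finset.univ.biUnion fun c => chainsFrom (Avoiding x.1 x.2) l c

theorem mem_omittingWords (hX : 2 ≤ Fintype.card X) {p q : X × Bool} (hpq : NonCancelling p q)
    {u : List (X × Bool)} (hu : IsReduced u) (h : ¬[p, q] <:+: u) :
    u ∈ omittingWords X u.length := by
  simp only [omittingWords, Finset.mem_biUnion, Finset.mem_filter, Finset.mem_univ, true_and,
    mem_chainsFrom]
  have hc := isChain_avoiding hu h
  refine ⟨(p, q), hpq, ?_⟩
  rcases u with _ | ⟨d, t⟩
  · exact ⟨p, by simp⟩
  · obtain ⟨c, h1, h2, -⟩ := exists_letter_notMem hX (d.1, !d.2) p p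
    refine ⟨c, List.isChain_cons_cons.2 ⟨⟨nonCancelling_iff.2 ?_, fun h => h2 h.1⟩, hc⟩⟩
    rintro rfl
    simp at h1

theorem card_omittingWords_le (hX : 2 ≤ Fintype.card X) {μ : ℝ} (hμ : 1 ≤ μ)
    (hμK : ((2 * Fintype.card X - 1 : ℕ) : ℝ) ^ 3 - 1 ≤ μ ^ 3) (l : ℕ) :
    ((omittingWords X l).card : ℝ) ≤
      (Fintype.card ((X × Bool) × (X × Bool)) * Fintype.card (X × Bool) *
        ((2 * Fintype.card X - 1 : ℕ) : ℝ) ^ 3) * μ ^ l := by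
  have hinner : ∀ x ∈ Finset.univ.filter
      (fun x : (X × Bool) × (X × Bool) => NonCancelling x.1 x.2),
      ((Finset.univ.biUnion fun c => chainsFrom (Avoiding x.1 x.2) l c).card : ℝ) ≤
        Fintype.card (X × Bool) * (((2 * Fintype.card X - 1 : ℕ) : ℝ) ^ 3 * μ ^ l) := by
    intro x hx
    have hx' : NonCancelling x.1 x.2 := by simpa using hx
    refine (Nat.cast_le.2 Finset.card_biUnion_le).trans ?_
    rw [Nat.cast_sum]
    refine (Finset.sum_le_card_nsmul _ _ _ fun c _ => card_chainsFrom_le (card_avoiding_le x.1 x.2)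
      (card_avoiding_self_add_one_le hx') (exists_avoiding_between hX x.1 x.2) hμ hμK l c).trans ?_
    rw [nsmul_eq_mul, Finset.card_univ]
  refine (Nat.cast_le.2 Finset.card_biUnion_le).trans ?_
  rw [Nat.cast_sum]
  refine (Finset.sum_le_card_nsmul _ _ _ hinner).trans ?_
  rw [nsmul_eq_mul, mul_assoc, mul_assoc]
  gcongr
  exact Finset.card_filter_le _ _

theorem pow_le_ncard_ball (hX : 2 ≤ Fintype.card X) (n : ℕ) :
    (2 * Fintype.card X - 1) ^ n ≤ {w : FreeGroup X | norm w ≤ n}.ncard := by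
  have : Nonempty X := Fintype.card_pos_iff.1 (by omega)
  obtain ⟨c⟩ : Nonempty (X × Bool) := inferInstance
  refine (pow_le_card_chainsFrom (r := NonCancelling (X := X))
    (fun a => (card_nonCancelling a).ge) n c).trans ?_
  have hred : ∀ t ∈ chainsFrom (NonCancelling (X := X)) n c, IsReduced t := by
    intro t ht
    exact (mem_chainsFrom.1 ht).2.tail
  rw [← Set.ncard_coe_finset]
  refine Set.ncard_le_ncard_of_injOn mk ?_ ?_ (finite_norm_le n)
  · intro t ht
    exact norm_mk_le.trans (mem_chainsFrom.1 ht).1.le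
  · intro t ht t' ht' h
    rw [← (hred t ht).reduce_eq, ← (hred t' ht').reduce_eq, ← toWord_mk, ← toWord_mk, h]

/-- Conjugates of length at most `n` of words omitting some reduced two-letter word. -/
def conjugatesOfOmitting (X : Type) [Fintype X] [DecidableEq X] (c : X × Bool) (n : ℕ) :
    Finset (FreeGroup X) :=
  ((Finset.range (n + 1) ×ˢ Finset.range (n + 1)).filter fun x => 2 * x.1 + x.2 ≤ n).biUnion
    fun x => Finset.image₂ (fun g u => mk (g ++ u ++ invRev g))
      (chainsFrom (fun _ _ => True) x.1 c) (omittingWords X x.2)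

theorem mem_conjugatesOfOmitting (hX : 2 ≤ Fintype.card X) (c : X × Bool) {n : ℕ}
    {w : FreeGroup X} (hw : norm w ≤ n) {p q : X × Bool} (hpq : NonCancelling p q)
    (h : ¬[p, q] <:+: reduceCyclically w.toWord) : w ∈ conjugatesOfOmitting X c n := by
  have hdec := reduceCyclically.conj_conjugator_reduceCyclically w.toWord
  set g := reduceCyclically.conjugator w.toWord
  have hu := (reduceCyclically.isCyclicallyReduced (isReduced_toWord (x := w))).isReduced
  set u := reduceCyclically w.toWord
  have hlen : 2 * g.length + u.length ≤ n := by
    have := congrArg List.length hdec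
    simp only [List.length_append, invRev_length] at this
    rw [norm] at hw
    omega
  simp only [conjugatesOfOmitting, Finset.mem_biUnion, Finset.mem_filter, Finset.mem_product,
    Finset.mem_range, Finset.mem_image₂]
  refine ⟨(g.length, u.length), ⟨⟨?_, ?_⟩, hlen⟩, g, ?_, u, mem_omittingWords hX hpq hu h, ?_⟩
  · dsimp only; omega
  · dsimp only; omega
  · rw [mem_chainsFrom]
    refine ⟨rfl, ?_⟩
    rw [List.isChain_iff_forall_rel_of_append_cons_cons]
    intros
    trivial
  · rw [hdec, mk_toWord]

theorem card_conjugatesOfOmitting_le (c : X × Bool) {μ C : ℝ} (hμ : 1 ≤ μ)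
    (hμX : 2 * (Fintype.card X : ℝ) ≤ μ ^ 2)
    (hC : ∀ l, ((omittingWords X l).card : ℝ) ≤ C * μ ^ l) (n : ℕ) :
    ((conjugatesOfOmitting X c n).card : ℝ) ≤ ((n : ℝ) + 1) ^ 2 * (C * μ ^ n) := by
  have hC0 : 0 ≤ C := by
    have := hC 0
    rw [pow_zero, mul_one] at this
    exact (Nat.cast_nonneg _).trans this
  refine (Nat.cast_le.2 Finset.card_biUnion_le).trans ?_
  rw [Nat.cast_sum]
  refine (Finset.sum_le_card_nsmul _ _ (C * μ ^ n) ?_).trans ?_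
  · rintro ⟨k, l⟩ hx
    have hkl : 2 * k + l ≤ n := (Finset.mem_filter.1 hx).2
    refine (Nat.cast_le.2 (Finset.card_image₂_le _ _ _)).trans ?_
    have hg : ((chainsFrom (fun _ _ => True) k c).card : ℝ) ≤ μ ^ (2 * k) := by
      have h1 := card_chainsFrom_le_pow (r := fun _ _ : X × Bool => True)
        (K := Fintype.card X * 2) (fun _ => by simp) k c
      calc ((chainsFrom (fun _ _ => True) k c).card : ℝ)
          ≤ ((Fintype.card X * 2 : ℕ) : ℝ) ^ k := by exact_mod_cast h1
        _ ≤ (μ ^ 2) ^ k := by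
            gcongr
            push_cast
            linarith
        _ = μ ^ (2 * k) := (pow_mul _ _ _).symm
    rw [Nat.cast_mul]
    calc _ ≤ μ ^ (2 * k) * (C * μ ^ l) := by
          gcongr
          exact hC l
      _ = C * μ ^ (2 * k + l) := by ring
      _ ≤ C * μ ^ n := by gcongr
  · rw [nsmul_eq_mul]
    gcongr
    have h1 := Finset.card_filter_le (Finset.range (n + 1) ×ˢ Finset.range (n + 1))
      fun x => 2 * x.1 + x.2 ≤ n
    rw [Finset.card_product, Finset.card_range] at h1
    rw [pow_two]
    exact_mod_cast h1

end Counting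

end FreeGroup

/-- the set of primitive elements of F(X), i.e.
{w : w = α(x) for some α ∈ Aut F(X) and some x ∈ X}, is exponentially F(X)-negligible. -/
theorem statement4 (X : Type) [Fintype X] [DecidableEq X] (hX : 2 ≤ Fintype.card X) :
    ExpGeneric
      (Set.univ \ {w : FreeGroup X | ∃ α : MulAut (FreeGroup X), ∃ x : X,
        w = α (FreeGroup.of x)})
      (Set.univ : Set (FreeGroup X)) := by
  have hnt : Nontrivial X := Fintype.one_lt_card_iff_nontrivial.1 hX
  obtain ⟨x₀⟩ : Nonempty X := inferInstance
  obtain ⟨K, hKdef⟩ : ∃ K, K = 2 * Fintype.card X - 1 := ⟨_, rfl⟩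
  obtain ⟨μ, hμ1, hμK, hμ3, hμ2⟩ := exists_rate (K := K) (by omega)
  have hμX : 2 * (Fintype.card X : ℝ) ≤ μ ^ 2 := by
    have : ((K + 1 : ℕ) : ℝ) = ((2 * Fintype.card X : ℕ) : ℝ) := by
      congr 1
      omega
    push_cast at this
    linarith
  have hK0 : (0 : ℝ) < K := by linarith
  obtain ⟨D, hD⟩ : ∃ D : ℝ, ∀ l, ((FreeGroup.omittingWords X l).card : ℝ) ≤ D * μ ^ l :=
    ⟨_, FreeGroup.card_omittingWords_le hX hμ1 (by rwa [← hKdef])⟩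
  have hD0 : 0 ≤ D := by
    have := hD 0
    rw [pow_zero, mul_one] at this
    exact (Nat.cast_nonneg _).trans this
  set s := Real.sqrt (μ / K) with hs
  have hq0 : 0 < μ / K := by positivity
  have hs0 : 0 < s := Real.sqrt_pos.2 hq0
  have hs1 : s < 1 := by
    rw [hs, Real.sqrt_lt' one_pos, one_pow, div_lt_one hK0]
    exact hμK
  have hsμ : s ^ 2 * K = μ := by
    rw [hs, Real.sq_sqrt hq0.le, div_mul_cancel₀ _ hK0.ne']
  obtain ⟨B, hB⟩ := exists_bound_sq_mul_pow hs0 hs1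
  have hB0 : 0 < B := by
    have := hB 0
    norm_num at this
    linarith
  refine ⟨B * D + 1, by positivity, s, hs0, hs1, fun n => ?_⟩
  have hball : ((K : ℝ)) ^ n ≤ ((Set.univ ∩ ballF X n).ncard : ℝ) := by
    rw [Set.univ_inter, hKdef]
    exact_mod_cast FreeGroup.pow_le_ncard_ball hX n
  have hsub : (Set.univ \ (Set.univ \ {w : FreeGroup X | ∃ α : MulAut (FreeGroup X), ∃ x : X,
      w = α (FreeGroup.of x)})) ∩ ballF X n ⊆
      (FreeGroup.conjugatesOfOmitting X (x₀, true) n : Set (FreeGroup X)) := by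
    rintro w ⟨hw, hn⟩
    simp only [Set.sdiff_sdiff_right_self, Set.univ_inter] at hw
    obtain ⟨α, x, rfl⟩ := hw
    obtain ⟨p, q, hpq, h⟩ := FreeGroup.exists_pair_omitted_of_primitive α x
    exact FreeGroup.mem_conjugatesOfOmitting hX _ hn hpq h
  calc _ ≤ ((FreeGroup.conjugatesOfOmitting X (x₀, true) n).card : ℝ) := by
        rw [← Set.ncard_coe_finset]
        exact_mod_cast Set.ncard_le_ncard hsub (Finset.finite_toSet _)
    _ ≤ ((n : ℝ) + 1) ^ 2 * (D * μ ^ n) :=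
        FreeGroup.card_conjugatesOfOmitting_le _ hμ1 hμX hD n
    _ = (((n : ℝ) + 1) ^ 2 * s ^ n) * D * s ^ n * K ^ n := by
        rw [← hsμ]
        ring
    _ ≤ (B * D + 1) * s ^ n * K ^ n := by
        have : ((n : ℝ) + 1) ^ 2 * s ^ n * D ≤ B * D + 1 := by
          nlinarith [hB n]
        gcongr
    _ ≤ _ := by gcongr
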